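/- arXiv:0712.0157 — 2 statements merged into one kernel-verified Lean document; each statement's English description precedes it below -/
import Mathlib

section
/- Let n ≥ 1, let B be a symmetric ℤ-bilinear form on ℤⁿ given by a symmetric integer matrix, and suppose ℝⁿ = V₊ ⊕ V₋ is a direct sum decomposition into subspaces orthogonal with respect to B, with B positive definite on V₊ and negative definite on V₋; for x ∈ ℝⁿ write x = x₊ + x₋ with x₊ ∈ V₊, x₋ ∈ V₋. Then for every τ in the upper half-plane ℍ, the family x ↦ exp(π i τ B(x₊,x₊) + π i τ̄ B(x₋,x₋)), indexed by x ∈ ℤⁿ, is (absolutely) summable, so the Siegel–Narain theta function Θ(τ) = Σ_{x∈ℤⁿ} exp(π i τ B(x₊,x₊) + π i τ̄ B(x₋,x₋)) is a well-defined complex number. -/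
open Matrix

/-- The real bilinear form on `ℝⁿ` determined by a symmetric integer matrix `B`. -/
noncomputable def intBilin (n : ℕ) (B : Matrix (Fin n) (Fin n) ℤ)
    (u v : Fin n → ℝ) : ℝ :=
  u ⬝ᵥ (B.map (Int.cast : ℤ → ℝ)).mulVec v

/-- The summand of the Siegel–Narain theta function:
`exp(π i τ B(x₊,x₊) + π i τ̄ B(x₋,x₋))`, where `x₊ = P x`, `x₋ = M x` are the
projections of `x ∈ ℤⁿ ⊂ ℝⁿ` onto `V₊` and `V₋`. -/
noncomputable def siegelNarainThetaTerm (n : ℕ) (B : Matrix (Fin n) (Fin n) ℤ)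
    (P M : (Fin n → ℝ) → (Fin n → ℝ)) (τ : ℂ) (x : Fin n → ℤ) : ℂ :=
  Complex.exp
    ((Real.pi : ℂ) * Complex.I * τ *
        ((intBilin n B (P fun i => (x i : ℝ)) (P fun i => (x i : ℝ)) : ℝ) : ℂ) +
      (Real.pi : ℂ) * Complex.I * (starRingEnd ℂ) τ *
        ((intBilin n B (M fun i => (x i : ℝ)) (M fun i => (x i : ℝ)) : ℝ) : ℂ))

/-- The Siegel–Narain theta function `Θ(τ)`. -/
noncomputable def siegelNarainTheta (n : ℕ) (B : Matrix (Fin n) (Fin n) ℤ)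
    (P M : (Fin n → ℝ) → (Fin n → ℝ)) (τ : ℂ) : ℂ :=
  ∑' x : Fin n → ℤ, siegelNarainThetaTerm n B P M τ x

/-- A positive continuous function that is homogeneous of degree two on a finite-dimensional space
dominates a positive multiple of the squared norm. -/
theorem exists_pos_mul_sq_norm_le {E : Type*} [NormedAddCommGroup E] [NormedSpace ℝ E]
    [FiniteDimensional ℝ E] {q : E → ℝ} (hcont : Continuous q)
    (hsmul : ∀ (t : ℝ) (x : E), q (t • x) = t ^ 2 * q x) (hpos : ∀ x, x ≠ 0 → 0 < q x) :
    ∃ c > 0, ∀ x, c * ‖x‖ ^ 2 ≤ q x := by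
  have hzero : q 0 = 0 := by simpa using hsmul 0 0
  rcases subsingleton_or_nontrivial E with hE | hE
  · exact ⟨1, one_pos, fun x => by simp [Subsingleton.elim x 0, hzero]⟩
  have : ProperSpace E := FiniteDimensional.proper ℝ E
  obtain ⟨u, hu, hmin⟩ := (isCompact_sphere (0 : E) 1).exists_isMinOn
    (NormedSpace.sphere_nonempty.2 zero_le_one) hcont.continuousOn
  refine ⟨q u, hpos u (ne_zero_of_mem_unit_sphere ⟨u, hu⟩), fun x => ?_⟩
  rcases eq_or_ne x 0 with rfl | hx
  · simp [hzero]
  have hnorm : ‖x‖ ≠ 0 := norm_ne_zero_iff.2 hx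
  have hle : q u ≤ q (‖x‖⁻¹ • x) := hmin (by simp [norm_smul, hnorm])
  calc q u * ‖x‖ ^ 2 ≤ q (‖x‖⁻¹ • x) * ‖x‖ ^ 2 := by gcongr
    _ = q x := by rw [hsmul]; field_simp

/-- The product of a nonnegative summable function over the coordinates is summable. -/
theorem summable_prod_apply_of_nonneg {α : Type*} {f : α → ℝ} (hf : Summable f)
    (hnonneg : ∀ a, 0 ≤ f a) (n : ℕ) : Summable fun x : Fin n → α => ∏ i, f (x i) := by
  induction n with
  | zero => exact .of_finite
  | succ n ih =>
    rw [← (Fin.consEquiv fun _ : Fin (n + 1) => α).summable_iff]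
    refine (hf.mul_of_nonneg ih hnonneg fun x => Finset.prod_nonneg fun i _ => hnonneg _).congr
      fun p => ?_
    simp [Fin.consEquiv, Fin.prod_univ_succ]

theorem summable_exp_neg_mul_sq_int {a : ℝ} (ha : 0 < a) :
    Summable fun m : ℤ => Real.exp (-a * (m : ℝ) ^ 2) := by
  have h := ((summable_jacobiTheta₂_term_iff 0 (((a / Real.pi : ℝ) : ℂ) * Complex.I)).2
    (by simpa using div_pos ha Real.pi_pos)).norm
  refine h.congr fun m => ?_
  rw [norm_jacobiTheta₂_term]
  congr 1
  simp
  field_simp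

/-- Summability over `ℤⁿ` of a Gaussian in the sup norm. -/
theorem summable_exp_neg_mul_sq_norm {a : ℝ} (ha : 0 < a) (n : ℕ) :
    Summable fun x : Fin n → ℤ => Real.exp (-a * ‖fun i => (x i : ℝ)‖ ^ 2) := by
  have hb : 0 < a / (n + 1) := by positivity
  refine (summable_prod_apply_of_nonneg (summable_exp_neg_mul_sq_int hb)
    (fun _ => (Real.exp_pos _).le) n).of_nonneg_of_le (fun _ => (Real.exp_pos _).le) fun x => ?_
  rw [← Real.exp_sum, Real.exp_le_exp, ← Finset.mul_sum, neg_mul, neg_mul, neg_le_neg_iff]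
  have hsum : ∑ i, (x i : ℝ) ^ 2 ≤ n * ‖fun i => (x i : ℝ)‖ ^ 2 := by
    simpa using Finset.sum_le_card_nsmul Finset.univ (fun i => (x i : ℝ) ^ 2)
      (‖fun i => (x i : ℝ)‖ ^ 2) fun i _ => by
        rw [← sq_abs]
        gcongr
        exact norm_le_pi_norm (fun i => (x i : ℝ)) i
  calc a / (n + 1) * ∑ i, (x i : ℝ) ^ 2
      ≤ a / (n + 1) * ((n + 1) * ‖fun i => (x i : ℝ)‖ ^ 2) := by
        gcongr
        nlinarith [sq_nonneg ‖fun i => (x i : ℝ)‖]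
    _ = a * ‖fun i => (x i : ℝ)‖ ^ 2 := by field_simp

theorem intBilin_smul_smul (n : ℕ) (B : Matrix (Fin n) (Fin n) ℤ) (t : ℝ) (u : Fin n → ℝ) :
    intBilin n B (t • u) (t • u) = t ^ 2 * intBilin n B u u := by
  simp only [intBilin, mulVec_smul, dotProduct_smul, smul_dotProduct, smul_eq_mul]
  ring

theorem continuous_intBilin_self (n : ℕ) (B : Matrix (Fin n) (Fin n) ℤ) :
    Continuous fun u : Fin n → ℝ => intBilin n B u u := by
  unfold intBilin
  fun_prop

theorem norm_siegelNarainThetaTerm (n : ℕ) (B : Matrix (Fin n) (Fin n) ℤ)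
    (P M : (Fin n → ℝ) → (Fin n → ℝ)) (τ : ℂ) (x : Fin n → ℤ) :
    ‖siegelNarainThetaTerm n B P M τ x‖ = Real.exp (-(Real.pi * τ.im) *
      (intBilin n B (P fun i => (x i : ℝ)) (P fun i => (x i : ℝ)) -
        intBilin n B (M fun i => (x i : ℝ)) (M fun i => (x i : ℝ)))) := by
  rw [siegelNarainThetaTerm, Complex.norm_exp]
  congr 1
  simp
  ring

theorem siegelNarainTheta_summable (n : ℕ) (hn : 1 ≤ n)
    (B : Matrix (Fin n) (Fin n) ℤ) (hBsymm : B.IsSymm)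
    (Vpos Vneg : Submodule ℝ (Fin n → ℝ)) (hcompl : IsCompl Vpos Vneg)
    (horth : ∀ u ∈ Vpos, ∀ v ∈ Vneg, intBilin n B u v = 0)
    (hpos : ∀ u ∈ Vpos, u ≠ 0 → 0 < intBilin n B u u)
    (hneg : ∀ v ∈ Vneg, v ≠ 0 → intBilin n B v v < 0)
    (P M : (Fin n → ℝ) → (Fin n → ℝ))
    (hP : ∀ x, P x ∈ Vpos) (hM : ∀ x, M x ∈ Vneg) (hPM : ∀ x, P x + M x = x)
    (τ : ℂ) (hτ : 0 < τ.im) :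
    Summable (fun x : Fin n → ℤ => siegelNarainThetaTerm n B P M τ x) := by
  have hproj : P = Vpos.projection Vneg hcompl := by
    ext1 x
    conv_rhs => rw [← hPM x, map_add, Submodule.projection_apply_of_mem_left hcompl (hP x),
      Submodule.projection_apply_of_mem_right hcompl (hM x), add_zero]
  have hMeq : M = (LinearMap.id - Vpos.projection Vneg hcompl :
      (Fin n → ℝ) →ₗ[ℝ] (Fin n → ℝ)) := by
    ext1 x
    rw [LinearMap.sub_apply, ← hproj, LinearMap.id_apply, eq_sub_iff_add_eq', hPM]
  obtain ⟨f, rfl⟩ : ∃ f : (Fin n → ℝ) →ₗ[ℝ] (Fin n → ℝ), P = f := ⟨_, hproj⟩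
  obtain ⟨g, rfl⟩ : ∃ g : (Fin n → ℝ) →ₗ[ℝ] (Fin n → ℝ), M = g := ⟨_, hMeq⟩
  have hposP (x) : 0 ≤ intBilin n B (f x) (f x) := by
    rcases eq_or_ne (f x) 0 with h | h
    · simp [h, intBilin]
    · exact (hpos _ (hP x) h).le
  have hnegM (x) : intBilin n B (g x) (g x) ≤ 0 := by
    rcases eq_or_ne (g x) 0 with h | h
    · simp [h, intBilin]
    · exact (hneg _ (hM x) h).le
  obtain ⟨c, hc, hle⟩ := exists_pos_mul_sq_norm_le
    (q := fun x => intBilin n B (f x) (f x) - intBilin n B (g x) (g x))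
    (((continuous_intBilin_self n B).comp f.continuous_of_finiteDimensional).sub
      ((continuous_intBilin_self n B).comp g.continuous_of_finiteDimensional))
    (fun t x => by simp only [map_smul, intBilin_smul_smul, mul_sub])
    (fun x hx => by
      rcases eq_or_ne (f x) 0 with h | h
      · have hgx : g x ≠ 0 := fun h' => hx (by rw [← hPM x, h, h', add_zero])
        linarith [hposP x, hneg _ (hM x) hgx]
      · linarith [hpos _ (hP x) h, hnegM x])
  have ha : 0 < Real.pi * τ.im := mul_pos Real.pi_pos hτ
  refine .of_norm_bounded (summable_exp_neg_mul_sq_norm (mul_pos ha hc) n) fun x => ?_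
  rw [norm_siegelNarainThetaTerm, Real.exp_le_exp, neg_mul, neg_mul, neg_le_neg_iff, mul_assoc]
  exact mul_le_mul_of_nonneg_left (hle _) ha.le
end

section
/- Let n ≥ 1 and let B be a symmetric ℤ-bilinear form on ℤⁿ which is even (B(x,x) ∈ 2ℤ for all x ∈ ℤⁿ) and unimodular (its matrix has determinant ±1), and fix an orthogonal splitting ℝⁿ = V₊ ⊕ V₋ as above, with p = dim V₊ and q = dim V₋. Assume the signature p − q is divisible by 8. Then the Siegel–Narain theta function transforms as a modular function of weights (p/2, q/2) under the inversion: for every τ in the upper half-plane ℍ, Θ(−1/τ) = τ^{p/2} · τ̄^{q/2} · Θ(τ), where the powers are principal branch complex powers. -/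
open Matrix

section PoissonSummation

open MeasureTheory Set

variable {ι : Type*}

/-- The half-open unit cube in `ℝ^ι` with lowest corner `k`. -/
def intCube (k : ι → ℤ) : Set (ι → ℝ) :=
  {x | ∀ i, x i ∈ Ioc (k i : ℝ) (k i + 1)}

theorem iUnion_intCube : ⋃ k : ι → ℤ, intCube k = univ := by
  refine eq_univ_of_forall fun x => mem_iUnion.2 ⟨fun i => ⌈x i⌉ - 1, fun i => ⟨?_, ?_⟩⟩
  · have := Int.ceil_lt_add_one (x i)
    push_cast
    linarith
  · have := Int.le_ceil (x i)
    push_cast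
    linarith

theorem pairwise_disjoint_intCube :
    Pairwise (Function.onFun Disjoint (intCube : (ι → ℤ) → Set (ι → ℝ))) := by
  intro k l hkl
  refine disjoint_left.2 fun x hx hy => hkl (funext fun i => ?_)
  have h₁ : (k i : ℝ) < l i + 1 := (hx i).1.trans_le (hy i).2
  have h₂ : (l i : ℝ) < k i + 1 := (hy i).1.trans_le (hx i).2
  norm_cast at h₁ h₂
  lia

theorem isQuotientMap_coe_unitAddTorus :
    Topology.IsQuotientMap (fun (x : ι → ℝ) i => (x i : UnitAddCircle)) :=
  (IsOpenQuotientMap.piMap (f := fun (_ : ι) (x : ℝ) => (x : UnitAddCircle))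
    fun _ => QuotientAddGroup.isOpenQuotientMap_mk).isQuotientMap

variable [Fintype ι]

theorem measurableSet_intCube (k : ι → ℤ) : MeasurableSet (intCube k) :=
  MeasurableSet.univ_pi' fun _ => measurableSet_Ioc

theorem volume_intCube (k : ι → ℤ) : volume (intCube k) = 1 := by
  have : intCube k = univ.pi fun i => Ioc (k i : ℝ) (k i + 1) := by
    ext x
    simp [intCube]
  simp [this, volume_pi_pi]

theorem norm_sub_intCast_le_one {k : ι → ℤ} {x : ι → ℝ} (hx : x ∈ intCube k) :
    ‖x - fun i => (k i : ℝ)‖ ≤ 1 := by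
  refine (pi_norm_le_iff_of_nonneg zero_le_one).2 fun i => ?_
  rw [Pi.sub_apply, Real.norm_eq_abs, abs_le]
  constructor <;> linarith [(hx i).1, (hx i).2]

theorem hasSum_setIntegral_intCube {E : Type*} [NormedAddCommGroup E] [NormedSpace ℝ E]
    {g : (ι → ℝ) → E} (hg : Integrable g) :
    HasSum (fun k : ι → ℤ => ∫ x in intCube k, g x) (∫ x, g x) := by
  have := hasSum_integral_iUnion (f := g) (μ := volume) measurableSet_intCube
    pairwise_disjoint_intCube hg.integrableOn
  rwa [iUnion_intCube, setIntegral_univ] at this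

theorem setIntegral_intCube {E : Type*} [NormedAddCommGroup E] [NormedSpace ℝ E]
    (g : (ι → ℝ) → E) (k : ι → ℤ) :
    ∫ x in intCube k, g x = ∫ x in intCube (0 : ι → ℤ), g (x + fun i => (k i : ℝ)) := by
  have := (measurePreserving_add_right (volume : Measure (ι → ℝ))
    (fun i => (k i : ℝ))).setIntegral_preimage_emb
      (MeasurableEquiv.addRight fun i => (k i : ℝ)).measurableEmbedding g (intCube k)
  rw [← this]
  congr 2
  ext x
  simp [intCube, add_comm (x _)]

theorem one_add_norm_rpow_le {r : ℝ} (hr : 0 ≤ r) {E : Type*} [NormedAddCommGroup E] (x y : E) :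
    (1 + ‖x + y‖) ^ (-r) ≤ (1 + ‖x‖) ^ r * (1 + ‖y‖) ^ (-r) := by
  have h : 1 + ‖y‖ ≤ (1 + ‖x‖) * (1 + ‖x + y‖) := by
    have : ‖y‖ ≤ ‖x‖ + ‖x + y‖ := by
      simpa using norm_add_le (-x) (x + y)
    nlinarith [mul_nonneg (norm_nonneg x) (norm_nonneg (x + y))]
  have h₁ : (1 + ‖y‖) ^ r ≤ (1 + ‖x‖) ^ r * (1 + ‖x + y‖) ^ r := by
    rw [← Real.mul_rpow (by positivity) (by positivity)]
    gcongr
  rw [Real.rpow_neg (by positivity), Real.rpow_neg (by positivity), inv_eq_one_div,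
    ← div_eq_mul_inv, div_le_div_iff₀ (by positivity) (by positivity)]
  linarith

theorem summable_one_add_norm_intCast_rpow {r : ℝ} (hr : (Fintype.card ι : ℝ) < r) :
    Summable fun k : ι → ℤ => (1 + ‖fun i => (k i : ℝ)‖) ^ (-r) := by
  have hr₀ : 0 ≤ r := (Nat.cast_nonneg _).trans hr.le
  have hint : Integrable fun x : ι → ℝ => (1 + ‖x‖) ^ (-r) :=
    integrable_one_add_norm (by simpa using hr)
  refine Summable.of_nonneg_of_le (fun k => by positivity) (fun k => ?_)
    ((hasSum_setIntegral_intCube hint).summable.mul_left ((2 : ℝ) ^ r))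
  have hle : ∀ x ∈ intCube k, (2 : ℝ) ^ (-r) * (1 + ‖fun i => (k i : ℝ)‖) ^ (-r) ≤
      (1 + ‖x‖) ^ (-r) := by
    intro x hx
    rw [← Real.mul_rpow (by positivity) (by positivity)]
    refine Real.rpow_le_rpow_of_nonpos (by positivity) ?_ (by linarith)
    have := norm_sub_intCast_le_one hx
    have h2 := norm_le_norm_sub_add x (fun i => (k i : ℝ))
    linarith [norm_nonneg (fun i => (k i : ℝ))]
  have := setIntegral_mono_on (μ := volume) (s := intCube k)
    (integrableOn_const (by simp [volume_intCube])) hint.integrableOn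
    (measurableSet_intCube k) hle
  rw [setIntegral_const, measureReal_def, volume_intCube] at this
  simp only [ENNReal.toReal_one, one_smul] at this
  calc _ = (2 : ℝ) ^ r * ((2 : ℝ) ^ (-r) * (1 + ‖fun i => (k i : ℝ)‖) ^ (-r)) := by
        rw [← mul_assoc, ← Real.rpow_add (by norm_num)]
        simp
    _ ≤ _ := by gcongr

theorem mFourier_neg_coe (n : ι → ℤ) (x : ι → ℝ) :
    UnitAddTorus.mFourier (-n) (fun i => (x i : UnitAddCircle)) =
      Complex.exp (∑ i, (-2 * Real.pi * Complex.I * n i) * x i) := by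
  simp only [UnitAddTorus.mFourier, ContinuousMap.coe_mk, fourier_coe_apply, Complex.exp_sum]
  refine Finset.prod_congr rfl fun i _ => ?_
  simp

theorem norm_add_intCast_le_of_decay {f : (ι → ℝ) → ℂ} {C r : ℝ} (hr : 0 ≤ r)
    (hf : ∀ x, ‖f x‖ ≤ C * (1 + ‖x‖) ^ (-r)) {R : ℝ} {x : ι → ℝ} (hx : ‖x‖ ≤ R) (k : ι → ℤ) :
    ‖f (x + fun i => (k i : ℝ))‖ ≤
      C * (1 + R) ^ r * (1 + ‖fun i => (k i : ℝ)‖) ^ (-r) := by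
  have hC : 0 ≤ C := by simpa using (norm_nonneg _).trans (hf 0)
  have := norm_nonneg x
  calc _ ≤ _ := hf _
    _ ≤ C * ((1 + ‖x‖) ^ r * (1 + ‖fun i => (k i : ℝ)‖) ^ (-r)) := by
      gcongr
      exact one_add_norm_rpow_le hr _ _
    _ ≤ C * ((1 + R) ^ r * (1 + ‖fun i => (k i : ℝ)‖) ^ (-r)) := by gcongr
    _ = _ := by ring

theorem continuous_tsum_add_intCast_of_decay {f : (ι → ℝ) → ℂ} (hc : Continuous f) {C r : ℝ}
    (hr : (Fintype.card ι : ℝ) < r) (hf : ∀ x, ‖f x‖ ≤ C * (1 + ‖x‖) ^ (-r)) :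
    Continuous fun x : ι → ℝ => ∑' k : ι → ℤ, f (x + fun i => (k i : ℝ)) := by
  have hr₀ : 0 ≤ r := (Nat.cast_nonneg _).trans hr.le
  refine continuous_iff_continuousAt.2 fun x₀ => ?_
  refine ContinuousOn.continuousAt (s := Metric.closedBall 0 (‖x₀‖ + 1)) ?_ ?_
  · refine continuousOn_tsum (fun k => by fun_prop)
      ((summable_one_add_norm_intCast_rpow hr).mul_left (C * (1 + (‖x₀‖ + 1)) ^ r))
      fun k x hx => ?_
    exact norm_add_intCast_le_of_decay hr₀ hf (by simpa using hx) k
  · refine Filter.mem_of_superset (Metric.ball_mem_nhds x₀ one_pos) fun x hx => ?_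
    rw [mem_ball_iff_norm] at hx
    rw [mem_closedBall_zero_iff]
    linarith [norm_le_norm_sub_add x x₀]

theorem integral_cexp_mul_eq_setIntegral_tsum {f : (ι → ℝ) → ℂ} (hc : Continuous f) {C r : ℝ}
    (hr : (Fintype.card ι : ℝ) < r) (hf : ∀ x, ‖f x‖ ≤ C * (1 + ‖x‖) ^ (-r)) (n : ι → ℤ) :
    ∫ x : ι → ℝ, UnitAddTorus.mFourier (-n) (fun i => (x i : UnitAddCircle)) * f x =
      ∫ x in intCube (0 : ι → ℤ), UnitAddTorus.mFourier (-n) (fun i => (x i : UnitAddCircle)) *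
        ∑' k : ι → ℤ, f (x + fun i => (k i : ℝ)) := by
  have hr₀ : 0 ≤ r := (Nat.cast_nonneg _).trans hr.le
  set e : (ι → ℝ) → ℂ := fun x => UnitAddTorus.mFourier (-n) (fun i => (x i : UnitAddCircle))
    with he
  have hecont : Continuous e := by
    have : Continuous fun (x : ι → ℝ) i => (x i : UnitAddCircle) :=
      isQuotientMap_coe_unitAddTorus.continuous
    fun_prop
  have heper : ∀ (x : ι → ℝ) (k : ι → ℤ), e (x + fun i => (k i : ℝ)) = e x := by
    intro x k
    simp only [he, Pi.add_apply, AddCircle.coe_add]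
    congr 1
    ext i
    simp
  have henorm : ∀ x, ‖e x‖ = 1 := by
    intro x
    simp only [he, UnitAddTorus.mFourier, ContinuousMap.coe_mk, fourier_apply, norm_prod,
      Circle.norm_coe, Finset.prod_const_one]
  have hint : Integrable fun x => e x * f x := by
    refine ((integrable_one_add_norm (E := ι → ℝ) (μ := volume)
      (by simpa using hr)).const_mul C).mono' (hecont.mul hc).aestronglyMeasurable ?_
    exact Filter.Eventually.of_forall fun x => by simpa [henorm] using hf x
  rw [← (hasSum_setIntegral_intCube hint).tsum_eq]
  simp_rw [setIntegral_intCube (fun x => e x * f x), heper, ← tsum_mul_left]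
  have hbound : ∀ k : ι → ℤ, ∀ x ∈ intCube (0 : ι → ℤ), ‖e x * f (x + fun i => (k i : ℝ))‖ ≤
      C * (1 + 1) ^ r * (1 + ‖fun i => (k i : ℝ)‖) ^ (-r) := by
    intro k x hx
    rw [norm_mul, henorm, one_mul]
    refine norm_add_intCast_le_of_decay hr₀ hf ?_ k
    have := norm_sub_intCast_le_one hx
    simp only [Pi.zero_apply, Int.cast_zero] at this
    simpa only [← Pi.zero_def, sub_zero] using this
  have hcont : ∀ k : ι → ℤ, Continuous fun x => e x * f (x + fun i => (k i : ℝ)) := fun k => by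
    fun_prop
  have hfin : ∀ k : ι → ℤ, IntegrableOn (fun x => e x * f (x + fun i => (k i : ℝ)))
      (intCube (0 : ι → ℤ)) := fun k =>
    Measure.integrableOn_of_bounded (by simp [volume_intCube])
      (hcont k).aestronglyMeasurable
      ((ae_restrict_iff' (measurableSet_intCube _)).2 (Filter.Eventually.of_forall (hbound k)))
  refine (hasSum_integral_of_summable_integral_norm hfin ?_).tsum_eq
  refine Summable.of_nonneg_of_le (fun k => integral_nonneg fun x => norm_nonneg _) (fun k => ?_)
    ((summable_one_add_norm_intCast_rpow hr).mul_left (C * (1 + 1) ^ r))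
  have := setIntegral_mono_on (μ := volume) (hfin k).norm
    (integrableOn_const (by simp [volume_intCube])) (measurableSet_intCube _) (hbound k)
  rw [setIntegral_const, measureReal_def, volume_intCube] at this
  simpa using this

/-- **Poisson summation** for functions on `ℝ^ι` with sufficiently fast polynomial decay. -/
theorem tsum_intCast_eq_tsum_integral_of_decay {f : (ι → ℝ) → ℂ} (hc : Continuous f) {C r : ℝ}
    (hr : (Fintype.card ι : ℝ) < r) (hf : ∀ x, ‖f x‖ ≤ C * (1 + ‖x‖) ^ (-r))
    (hs : Summable fun n : ι → ℤ =>
      ∫ x : ι → ℝ, Complex.exp (∑ i, (-2 * Real.pi * Complex.I * n i) * x i) * f x) :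
    ∑' k : ι → ℤ, f (fun i => (k i : ℝ)) = ∑' n : ι → ℤ,
      ∫ x : ι → ℝ, Complex.exp (∑ i, (-2 * Real.pi * Complex.I * n i) * x i) * f x := by
  simp_rw [← mFourier_neg_coe] at hs ⊢
  let G : C(ι → ℝ, ℂ) := ⟨_, continuous_tsum_add_intCast_of_decay hc hr hf⟩
  let π : C(ι → ℝ, UnitAddTorus ι) := ⟨_, isQuotientMap_coe_unitAddTorus.continuous⟩
  have hπ : Topology.IsQuotientMap π := isQuotientMap_coe_unitAddTorus
  have hfac : Function.FactorsThrough G π := by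
    intro x y hxy
    have h : ∀ i, ∃ m : ℤ, x i = y i + m := by
      intro i
      have : (x i : UnitAddCircle) = y i := congrFun hxy i
      rw [← sub_eq_zero, ← AddCircle.coe_sub, AddCircle.coe_eq_zero_iff] at this
      obtain ⟨m, hm⟩ := this
      exact ⟨m, by rw [zsmul_one] at hm; linarith⟩
    choose m hm using h
    have hx : x = y + fun i => (m i : ℝ) := funext hm
    change ∑' k : ι → ℤ, f (x + fun i => (k i : ℝ)) = ∑' k : ι → ℤ, f (y + fun i => (k i : ℝ))
    rw [← (Equiv.addLeft m).tsum_eq fun k : ι → ℤ => f (y + fun i => (k i : ℝ))]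
    refine tsum_congr fun k => ?_
    congr 1
    rw [hx]
    ext i
    simp [add_assoc]
  let F : C(UnitAddTorus ι, ℂ) := hπ.lift G hfac
  have hF : ∀ x : ι → ℝ, F (fun i => (x i : UnitAddCircle)) =
      ∑' k : ι → ℤ, f (x + fun i => (k i : ℝ)) := fun x =>
    congrArg (fun g : C(ι → ℝ, ℂ) => g x) (hπ.lift_comp G hfac)
  have hcoeff : ∀ n, UnitAddTorus.mFourierCoeff F n =
      ∫ x : ι → ℝ, UnitAddTorus.mFourier (-n) (fun i => (x i : UnitAddCircle)) * f x := by
    intro n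
    rw [integral_cexp_mul_eq_setIntegral_tsum hc hr hf,
      UnitAddTorus.mFourierCoeff_eq_integral _ _ 0]
    simp [hF, intCube]
  simp_rw [← hcoeff] at hs ⊢
  have := (UnitAddTorus.hasSum_mFourier_series_apply_of_summable hs
    (fun i => ((0 : ι → ℝ) i : UnitAddCircle))).tsum_eq
  rw [hF] at this
  simpa [UnitAddTorus.mFourier] using this.symm

end PoissonSummation

section GaussianLatticeSum

open MeasureTheory

variable {ι : Type*} [Fintype ι]

theorem exp_neg_mul_sq_le {c : ℝ} (hc : 0 < c) (m : ℕ) {t : ℝ} (ht : 0 ≤ t) :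
    Real.exp (-(c * t ^ 2)) ≤
      (m.factorial * Real.exp (1 + 1 / (4 * c))) * (1 + t) ^ (-(m : ℝ)) := by
  rw [Real.rpow_neg (by positivity), Real.rpow_natCast, ← div_eq_mul_inv,
    le_div_iff₀ (by positivity)]
  have h₁ : (1 + t) ^ m ≤ Real.exp (1 + t) * m.factorial :=
    (div_le_iff₀ (by positivity)).1 (Real.pow_div_factorial_le_exp _ (by positivity) m)
  have h₂ : -(c * t ^ 2) + (1 + t) ≤ 1 + 1 / (4 * c) := by
    have : 1 / (4 * c) - t + c * t ^ 2 = (2 * c * t - 1) ^ 2 / (4 * c) := by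
      field_simp
      ring
    have : 0 ≤ (2 * c * t - 1) ^ 2 / (4 * c) := by positivity
    linarith
  calc _ ≤ Real.exp (-(c * t ^ 2)) * (Real.exp (1 + t) * m.factorial) := by gcongr
    _ = m.factorial * Real.exp (-(c * t ^ 2) + (1 + t)) := by
      rw [Real.exp_add (-(c * t ^ 2))]
      ring
    _ ≤ _ := by gcongr

theorem exists_norm_le_mul_norm_mulVec [DecidableEq ι] {L N : Matrix ι ι ℝ} (h : L * N = 1) :
    ∃ K > 0, ∀ x : ι → ℝ, ‖x‖ ≤ K * ‖N *ᵥ x‖ := by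
  obtain ⟨K, hK, hle⟩ := (LinearMap.toContinuousLinearMap L.mulVecLin).bound
  refine ⟨K, hK, fun x => ?_⟩
  simpa [mulVec_mulVec, h] using hle (N *ᵥ x)

theorem exists_norm_cexp_neg_sum_sq_mulVec_le [DecidableEq ι] {b : ι → ℂ}
    (hb : ∀ i, 0 < (b i).re) {L N : Matrix ι ι ℝ} (h : L * N = 1) (m : ℕ) :
    ∃ C, ∀ x : ι → ℝ, ‖Complex.exp (-∑ i, b i * ((N *ᵥ x) i : ℂ) ^ 2)‖ ≤
      C * (1 + ‖x‖) ^ (-(m : ℝ)) := by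
  obtain ⟨K, hK, hle⟩ := exists_norm_le_mul_norm_mulVec h
  obtain ⟨c, hc, hcb⟩ : ∃ c > 0, ∀ i, c ≤ (b i).re := by
    obtain hι | hι := isEmpty_or_nonempty ι
    · exact ⟨1, one_pos, fun i => isEmptyElim i⟩
    · obtain ⟨i₀, hi₀⟩ := Finite.exists_min fun i => (b i).re
      exact ⟨_, hb i₀, hi₀⟩
  refine ⟨_, fun x => le_trans ?_
    (exp_neg_mul_sq_le (c := c / K ^ 2) (by positivity) m (norm_nonneg x))⟩
  have hre : (-∑ i, b i * ((N *ᵥ x) i : ℂ) ^ 2).re = -∑ i, (b i).re * (N *ᵥ x) i ^ 2 := by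
    rw [Complex.neg_re, Complex.re_sum]
    congr 1
    refine Finset.sum_congr rfl fun i _ => ?_
    rw [← Complex.ofReal_pow, Complex.re_mul_ofReal]
  rw [Complex.norm_exp, hre]
  gcongr
  have hsq : ‖N *ᵥ x‖ ^ 2 ≤ ∑ i, (N *ᵥ x) i ^ 2 := by
    refine (Real.le_sqrt (norm_nonneg _) (by positivity)).1
      ((pi_norm_le_iff_of_nonneg (Real.sqrt_nonneg _)).2 fun i => Real.abs_le_sqrt ?_)
    exact Finset.single_le_sum (f := fun i => (N *ᵥ x) i ^ 2) (fun _ _ => sq_nonneg _)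
      (Finset.mem_univ i)
  calc c / K ^ 2 * ‖x‖ ^ 2 ≤ c / K ^ 2 * (K * ‖N *ᵥ x‖) ^ 2 := by
        gcongr
        exact hle x
    _ = c * ‖N *ᵥ x‖ ^ 2 := by field_simp
    _ ≤ c * ∑ i, (N *ᵥ x) i ^ 2 := by gcongr
    _ ≤ _ := by
      rw [Finset.mul_sum]
      gcongr with i
      exact hcb i

theorem measurePreserving_mulVec [DecidableEq ι] {L : Matrix ι ι ℝ} (hL : |L.det| = 1) :
    MeasurePreserving (fun x : ι → ℝ => L *ᵥ x) where
  measurable := by fun_prop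
  map_eq := by
    have h := Real.map_matrix_volume_pi_eq_smul_volume_pi (M := L) (by
      intro h
      simp [h] at hL)
    rw [abs_inv, hL] at h
    have hcoe : ⇑(toLin' L) = fun x => L *ᵥ x := funext fun x => toLin'_apply L x
    rwa [hcoe, inv_one, ENNReal.ofReal_one, one_smul] at h

theorem integral_cexp_mul_gaussian [DecidableEq ι] {b : ι → ℂ}
    (hb : ∀ i, 0 < (b i).re) {L N : Matrix ι ι ℝ} (h : L * N = 1) (hL : |L.det| = 1)
    (n : ι → ℤ) :
    ∫ x : ι → ℝ, Complex.exp (∑ i, (-2 * Real.pi * Complex.I * n i) * x i) *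
        Complex.exp (-∑ i, b i * ((N *ᵥ x) i : ℂ) ^ 2) =
      (∏ i, (Real.pi / b i) ^ (1 / 2 : ℂ)) *
        Complex.exp (-∑ i, (Real.pi ^ 2 / b i) * ((Lᵀ *ᵥ fun j => (n j : ℝ)) i : ℂ) ^ 2) := by
  have h' : N * L = 1 := mul_eq_one_comm.1 h
  have hemb : MeasurableEmbedding fun x : ι → ℝ => L *ᵥ x :=
    (Continuous.measurableEmbedding (by fun_prop) fun x y hxy => by
      simpa [mulVec_mulVec, h'] using congrArg (N *ᵥ ·) hxy)
  rw [← (measurePreserving_mulVec hL).integral_comp hemb]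
  have hdual : ∀ x : ι → ℝ, ∑ i, (-2 * Real.pi * Complex.I * n i) * ((L *ᵥ x) i : ℂ) =
      ∑ i, (-2 * Real.pi * Complex.I * ((Lᵀ *ᵥ fun j => (n j : ℝ)) i : ℂ)) * x i := by
    intro x
    have := dotProduct_mulVec (fun j => (n j : ℝ)) L x
    rw [← mulVec_transpose] at this
    have := congrArg (fun t : ℝ => -2 * Real.pi * Complex.I * (t : ℂ)) this
    simpa [dotProduct, Finset.mul_sum, mul_assoc] using this
  simp_rw [mulVec_mulVec, h', one_mulVec, hdual, ← Complex.exp_add, add_comm (∑ i, _ * _)]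
  rw [GaussianFourier.integral_cexp_neg_sum_mul_add hb, Finset.prod_mul_distrib, ← Complex.exp_sum,
    ← Finset.sum_neg_distrib]
  congr 2
  refine Finset.sum_congr rfl fun i _ => ?_
  have : b i ≠ 0 := fun h0 => by simpa [h0] using hb i
  field_simp
  rw [Complex.I_sq]
  ring

/-- The inversion formula for the sum of a complex Gaussian over `ℤ^ι`, with quadratic form
diagonalized by the unimodular real matrix `N = L⁻¹`. -/
theorem tsum_cexp_neg_sum_sq_mulVec [DecidableEq ι] {b : ι → ℂ}
    (hb : ∀ i, 0 < (b i).re) {L N : Matrix ι ι ℝ} (h : L * N = 1) (hL : |L.det| = 1) :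
    ∑' k : ι → ℤ, Complex.exp (-∑ i, b i * ((N *ᵥ fun j => (k j : ℝ)) i : ℂ) ^ 2) =
      (∏ i, (Real.pi / b i) ^ (1 / 2 : ℂ)) * ∑' k : ι → ℤ,
        Complex.exp (-∑ i, (Real.pi ^ 2 / b i) * ((Lᵀ *ᵥ fun j => (k j : ℝ)) i : ℂ) ^ 2) := by
  have hr : (Fintype.card ι : ℝ) < (Fintype.card ι + 1 : ℕ) := by simp
  obtain ⟨C, hC⟩ := exists_norm_cexp_neg_sum_sq_mulVec_le hb h (Fintype.card ι + 1)
  have hb' : ∀ i, 0 < (Real.pi ^ 2 / b i : ℂ).re := by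
    intro i
    have : b i ≠ 0 := fun h0 => by simpa [h0] using hb i
    have := Complex.normSq_pos.2 this
    have := hb i
    rw [← Complex.ofReal_pow, Complex.div_re, Complex.ofReal_re, Complex.ofReal_im]
    simp only [zero_mul, zero_div, add_zero]
    positivity
  have ht : Nᵀ * Lᵀ = 1 := by rw [← transpose_mul, h, transpose_one]
  obtain ⟨C', hC'⟩ := exists_norm_cexp_neg_sum_sq_mulVec_le hb' ht (Fintype.card ι + 1)
  have hs : Summable fun k : ι → ℤ =>
      Complex.exp (-∑ i, (Real.pi ^ 2 / b i) * ((Lᵀ *ᵥ fun j => (k j : ℝ)) i : ℂ) ^ 2) :=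
    Summable.of_norm_bounded ((summable_one_add_norm_intCast_rpow hr).mul_left C')
      fun k => hC' _
  rw [← tsum_mul_left, tsum_intCast_eq_tsum_integral_of_decay
    (f := fun x => Complex.exp (-∑ i, b i * ((N *ᵥ x) i : ℂ) ^ 2)) ?_ hr hC ?_]
  · simp_rw [integral_cexp_mul_gaussian hb h hL]
  · have : Continuous fun x : ι → ℝ => N *ᵥ x := by fun_prop
    fun_prop
  · simp_rw [integral_cexp_mul_gaussian hb h hL]
    exact hs.mul_left _

end GaussianLatticeSum

section AdaptedBasis

open Module

theorem exists_basis_eq_ite {V : Type*} [AddCommGroup V] [Module ℝ V] [FiniteDimensional ℝ V]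
    {β : LinearMap.BilinForm ℝ V} (hsymm : LinearMap.IsSymm β) (hpos : ∀ v, v ≠ 0 → 0 < β v v) :
    ∃ v : Basis (Fin (finrank ℝ V)) ℝ V, ∀ i j, β (v i) (v j) = if i = j then 1 else 0 := by
  have : Invertible (2 : ℝ) := invertibleOfNonzero two_ne_zero
  obtain ⟨v, hv⟩ := LinearMap.BilinForm.exists_orthogonal_basis hsymm
  have hvpos : ∀ i, 0 < β (v i) (v i) := fun i => hpos _ (v.ne_zero i)
  refine ⟨v.isUnitSMul (w := fun i => (Real.sqrt (β (v i) (v i)))⁻¹) fun i =>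
    ((inv_pos.2 (Real.sqrt_pos.2 (hvpos i))).ne').isUnit, fun i j => ?_⟩
  simp only [Basis.isUnitSMul_apply, map_smul, LinearMap.smul_apply, smul_eq_mul]
  split_ifs with h
  · subst h
    have := Real.mul_self_sqrt (hvpos i).le
    have := Real.sqrt_pos.2 (hvpos i)
    field_simp
    nlinarith
  · have : β (v i) (v j) = 0 := hv h
    simp [this]

variable {n : ℕ} {B : Matrix (Fin n) (Fin n) ℤ} {Vpos Vneg : Submodule ℝ (Fin n → ℝ)}

theorem intBilin_comm (hB : B.IsSymm) (u v : Fin n → ℝ) : intBilin n B u v = intBilin n B v u := by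
  have : (B.map (Int.cast : ℤ → ℝ))ᵀ = B.map (Int.cast : ℤ → ℝ) := by
    rw [← transpose_map, hB.eq]
  rw [intBilin, dotProduct_mulVec, ← mulVec_transpose, this, dotProduct_comm, intBilin]

/-- A basis adapted to an orthogonal splitting into a positive and a negative definite subspace:
the columns of `L` lie in `Vpos` or `Vneg` and diagonalize the form to `±1`. -/
theorem exists_matrix_transpose_mul_mul_eq_diagonal (hB : B.IsSymm) (hcompl : IsCompl Vpos Vneg)
    (horth : ∀ u ∈ Vpos, ∀ v ∈ Vneg, intBilin n B u v = 0)
    (hpos : ∀ u ∈ Vpos, u ≠ 0 → 0 < intBilin n B u u)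
    (hneg : ∀ v ∈ Vneg, v ≠ 0 → intBilin n B v v < 0) :
    ∃ (s : Fin n → Bool) (L : Matrix (Fin n) (Fin n) ℝ),
      (∀ i, s i = true → L.col i ∈ Vpos) ∧ (∀ i, s i = false → L.col i ∈ Vneg) ∧
      Fintype.card {i // s i = true} = finrank ℝ Vpos ∧
      Fintype.card {i // s i = false} = finrank ℝ Vneg ∧
      Lᵀ * B.map (Int.cast : ℤ → ℝ) * L = diagonal fun i => if s i then 1 else -1 := by
  let β : LinearMap.BilinForm ℝ (Fin n → ℝ) := Matrix.toBilin' (B.map (Int.cast : ℤ → ℝ))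
  have hβ : ∀ u v, β u v = intBilin n B u v := fun u v => toBilin'_apply' _ u v
  obtain ⟨v, hv⟩ := exists_basis_eq_ite (V := Vpos) (β := β.restrict Vpos)
    ⟨fun x y => by simpa [hβ] using intBilin_comm hB _ _⟩
    (fun x hx => by simpa [hβ] using hpos x x.2 (by simpa using hx))
  obtain ⟨w, hw⟩ := exists_basis_eq_ite (V := Vneg) (β := (-β).restrict Vneg)
    ⟨fun x y => by simpa [hβ] using intBilin_comm hB _ _⟩
    (fun x hx => by simpa [hβ] using hneg x x.2 (by simpa using hx))
  have hcard : Fintype.card (Fin n) =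
      Fintype.card (Fin (finrank ℝ Vpos) ⊕ Fin (finrank ℝ Vneg)) := by
    simp [Submodule.finrank_add_eq_of_isCompl hcompl]
  let e := Fintype.equivOfCardEq hcard
  let c : Fin (finrank ℝ Vpos) ⊕ Fin (finrank ℝ Vneg) → Fin n → ℝ :=
    Sum.elim (fun i => v i) fun i => w i
  have hc : ∀ i j, intBilin n B (c i) (c j) =
      if i = j then (if i.isLeft then 1 else -1) else 0 := by
    rintro (i | i) (j | j)
    · simpa [hβ, c] using hv i j
    · simpa [c] using horth _ (v i).2 _ (w j).2
    · simpa [c] using (intBilin_comm hB _ _).trans (horth _ (v j).2 _ (w i).2)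
    · have : -intBilin n B (w i) (w j) = if i = j then 1 else 0 := by
        rw [← hw i j, ← hβ]
        rfl
      simp only [c, Sum.elim_inr, Sum.inr.injEq, Sum.isLeft_inr, Bool.false_eq_true, if_false]
      split_ifs at this ⊢ <;> linarith
  refine ⟨fun i => (e i).isLeft, of fun j i => c (e i) j, fun i hi => ?_, fun i hi => ?_,
    ?_, ?_, ?_⟩
  · obtain ⟨a, ha⟩ := Sum.isLeft_iff.1 hi
    have : (of fun j i => c (e i) j).col i = v a := by
      ext j
      simp [ha, c]
    rw [this]
    exact (v a).2
  · obtain ⟨a, ha⟩ := Sum.isRight_iff.1 (Sum.isLeft_eq_false.1 hi)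
    have : (of fun j i => c (e i) j).col i = w a := by
      ext j
      simp [ha, c]
    rw [this]
    exact (w a).2
  · rw [Fintype.card_congr ((e.subtypeEquiv fun i => Iff.rfl).trans Equiv.sumIsLeft),
      Fintype.card_fin]
  · rw [Fintype.card_congr ((e.subtypeEquiv fun i => Sum.isLeft_eq_false).trans Equiv.sumIsRight),
      Fintype.card_fin]
  · ext i j
    have := hc (e i) (e j)
    rw [diagonal_apply]
    simp only [EmbeddingLike.apply_eq_iff_eq] at this
    rw [← this, intBilin, dotProduct_mulVec]
    rfl

end AdaptedBasis

section ThetaInversion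

variable {n : ℕ} {B : Matrix (Fin n) (Fin n) ℤ} {Vpos Vneg : Submodule ℝ (Fin n → ℝ)}

theorem mulVec_mem_of_col_mem {ι κ : Type*} [Fintype κ] {V : Submodule ℝ (ι → ℝ)}
    {L : Matrix ι κ ℝ} {y : κ → ℝ} (h : ∀ i, y i ≠ 0 → L.col i ∈ V) : L *ᵥ y ∈ V := by
  rw [mulVec_eq_sum]
  refine V.sum_mem fun i _ => ?_
  by_cases hy : y i = 0
  · simp [hy]
  · rw [op_smul_eq_smul]
    exact V.smul_mem _ (h i hy)

theorem intBilin_mulVec_self {L : Matrix (Fin n) (Fin n) ℝ} {d : Fin n → ℝ}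
    (h : Lᵀ * B.map (Int.cast : ℤ → ℝ) * L = diagonal d) (y : Fin n → ℝ) :
    intBilin n B (L *ᵥ y) (L *ᵥ y) = ∑ i, d i * y i ^ 2 := by
  have : intBilin n B (L *ᵥ y) (L *ᵥ y) = y ⬝ᵥ (diagonal d) *ᵥ y := by
    rw [← h, intBilin, ← mulVec_mulVec, ← mulVec_mulVec, dotProduct_mulVec y Lᵀ, vecMul_transpose]
  rw [this]
  simp only [dotProduct, mulVec_diagonal]
  exact Finset.sum_congr rfl fun i _ => by ring

theorem siegelNarainThetaTerm_eq_cexp {s : Fin n → Bool} {L N : Matrix (Fin n) (Fin n) ℝ}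
    (hdisj : Disjoint Vpos Vneg) (hLN : L * N = 1)
    (hLpos : ∀ i, s i = true → L.col i ∈ Vpos) (hLneg : ∀ i, s i = false → L.col i ∈ Vneg)
    (hD : Lᵀ * B.map (Int.cast : ℤ → ℝ) * L = diagonal fun i => if s i then 1 else -1)
    {P M : (Fin n → ℝ) → (Fin n → ℝ)}
    (hP : ∀ x, P x ∈ Vpos) (hM : ∀ x, M x ∈ Vneg) (hPM : ∀ x, P x + M x = x)
    (τ : ℂ) (x : Fin n → ℤ) :
    siegelNarainThetaTerm n B P M τ x = Complex.exp (-∑ i,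
      (if s i then -(Real.pi * Complex.I * τ) else Real.pi * Complex.I * (starRingEnd ℂ) τ) *
        ((N *ᵥ fun j => (x j : ℝ)) i : ℂ) ^ 2) := by
  set y := N *ᵥ fun j => (x j : ℝ) with hy
  set u := L *ᵥ fun i => if s i then y i else 0 with hu
  set v := L *ᵥ fun i => if s i then 0 else y i with hv
  have huv : u + v = fun j => (x j : ℝ) := by
    rw [hu, hv, ← mulVec_add]
    have : ((fun i => if s i then y i else 0) + fun i => if s i then 0 else y i) = y := by
      ext i
      by_cases h : s i <;> simp [h]
    rw [this, hy, mulVec_mulVec, hLN, one_mulVec]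
  have hu_mem : u ∈ Vpos := mulVec_mem_of_col_mem fun i hi => hLpos i (by simp_all)
  have hv_mem : v ∈ Vneg := mulVec_mem_of_col_mem fun i hi => hLneg i (by simp_all)
  have hsub : P (fun j => (x j : ℝ)) - u = v - M fun j => (x j : ℝ) := by
    rw [sub_eq_sub_iff_add_eq_add, hPM, ← huv, add_comm]
  have hzero : P (fun j => (x j : ℝ)) - u = 0 :=
    Submodule.disjoint_def.1 hdisj _ (Vpos.sub_mem (hP _) hu_mem)
      (hsub ▸ Vneg.sub_mem hv_mem (hM _))
  have hPu : P (fun j => (x j : ℝ)) = u := sub_eq_zero.1 hzero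
  have hMv : M (fun j => (x j : ℝ)) = v := (sub_eq_zero.1 (hsub ▸ hzero)).symm
  rw [siegelNarainThetaTerm, hPu, hMv, hu, hv, intBilin_mulVec_self hD, intBilin_mulVec_self hD]
  congr 1
  push_cast
  rw [Finset.mul_sum, Finset.mul_sum, ← Finset.sum_add_distrib, ← Finset.sum_neg_distrib]
  refine Finset.sum_congr rfl fun i _ => ?_
  by_cases h : s i <;> simp [h]

theorem abs_det_eq_one_of_transpose_mul_mul {L A D : Matrix (Fin n) (Fin n) ℝ}
    (h : Lᵀ * A * L = D) (hA : |A.det| = 1) (hD : |D.det| = 1) : |L.det| = 1 := by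
  have := congrArg (fun X => |X.det|) h
  simp only [det_mul, det_transpose, abs_mul, hA, hD, mul_one] at this
  exact (mul_self_eq_one_iff.1 this).resolve_right (by linarith [abs_nonneg L.det])

theorem cpow_mul_cpow_conj_eq {τ : ℂ} (hτ : 0 < τ.im) {p q : ℕ} (h : (8 : ℤ) ∣ (p : ℤ) - q) :
    ((-Complex.I * τ) ^ (1 / 2 : ℂ)) ^ p *
        ((Complex.I * (starRingEnd ℂ) τ) ^ (1 / 2 : ℂ)) ^ q =
      τ ^ ((p : ℂ) / 2) * ((starRingEnd ℂ) τ) ^ ((q : ℂ) / 2) := by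
  have h0 : τ ≠ 0 := by
    rintro rfl
    simp at hτ
  have h0' : (starRingEnd ℂ) τ ≠ 0 := by simpa using h0
  have harg₀ : 0 ≤ τ.arg := Complex.arg_nonneg_iff.2 hτ.le
  have harg_pi : τ.arg < Real.pi := Complex.arg_lt_pi_iff.2 (Or.inr hτ.ne')
  have hlog : Complex.log (-Complex.I * τ) = -(Real.pi / 2) * Complex.I + Complex.log τ := by
    rw [(Complex.log_mul_eq_add_log_iff (by simp) h0).2, Complex.log_neg_I]
    rw [Complex.arg_neg_I]
    constructor <;> linarith
  have hlog' : Complex.log (Complex.I * (starRingEnd ℂ) τ) =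
      Real.pi / 2 * Complex.I + Complex.log ((starRingEnd ℂ) τ) := by
    rw [(Complex.log_mul_eq_add_log_iff (by simp) h0').2, Complex.log_I]
    rw [Complex.arg_I, Complex.arg_conj, if_neg harg_pi.ne]
    constructor <;> linarith
  obtain ⟨m, hm⟩ := h
  have hpq : (p : ℂ) = q + 8 * m := by
    have := congrArg (Int.cast : ℤ → ℂ) hm
    push_cast at this
    linear_combination this
  rw [Complex.cpow_def_of_ne_zero (by simpa using h0),
    Complex.cpow_def_of_ne_zero (by simpa using h0),
    Complex.cpow_def_of_ne_zero h0, Complex.cpow_def_of_ne_zero h0', hlog, hlog',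
    ← Complex.exp_nat_mul, ← Complex.exp_nat_mul, ← Complex.exp_add, ← Complex.exp_add,
    Complex.exp_eq_exp_iff_exists_int]
  refine ⟨-m, ?_⟩
  push_cast
  rw [hpq]
  ring

end ThetaInversion

theorem siegelNarainTheta_inversion (n : ℕ) (hn : 1 ≤ n)
    (B : Matrix (Fin n) (Fin n) ℤ) (hBsymm : B.IsSymm)
    (hBeven : ∀ x : Fin n → ℤ, ∃ k : ℤ, x ⬝ᵥ B.mulVec x = 2 * k)
    (hBunimodular : B.det = 1 ∨ B.det = -1)
    (Vpos Vneg : Submodule ℝ (Fin n → ℝ)) (hcompl : IsCompl Vpos Vneg)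
    (horth : ∀ u ∈ Vpos, ∀ v ∈ Vneg, intBilin n B u v = 0)
    (hpos : ∀ u ∈ Vpos, u ≠ 0 → 0 < intBilin n B u u)
    (hneg : ∀ v ∈ Vneg, v ≠ 0 → intBilin n B v v < 0)
    (p q : ℕ) (hp : Module.finrank ℝ Vpos = p) (hq : Module.finrank ℝ Vneg = q)
    (hsig : (8 : ℤ) ∣ (p : ℤ) - (q : ℤ))
    (P M : (Fin n → ℝ) → (Fin n → ℝ))
    (hP : ∀ x, P x ∈ Vpos) (hM : ∀ x, M x ∈ Vneg) (hPM : ∀ x, P x + M x = x) :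
    ∀ τ : ℂ, 0 < τ.im →
      siegelNarainTheta n B P M (-1 / τ) =
        τ ^ ((p : ℂ) / 2) * ((starRingEnd ℂ) τ) ^ ((q : ℂ) / 2) *
          siegelNarainTheta n B P M τ := by
  intro τ hτ
  obtain ⟨s, L, hLpos, hLneg, hcp, hcq, hD⟩ :=
    exists_matrix_transpose_mul_mul_eq_diagonal hBsymm hcompl horth hpos hneg
  have h0 : τ ≠ 0 := by
    rintro rfl
    simp at hτ
  have h0' : (starRingEnd ℂ) τ ≠ 0 := by simpa using h0
  have hL : |L.det| = 1 := by
    refine abs_det_eq_one_of_transpose_mul_mul hD ?_ ?_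
    · have : (B.map (Int.cast : ℤ → ℝ)).det = (B.det : ℝ) := (Int.cast_det B).symm
      rw [this]
      obtain h | h := hBunimodular <;> simp [h]
    · rw [det_diagonal, Finset.abs_prod]
      exact Finset.prod_eq_one fun i _ => by split_ifs <;> simp
  set N : Matrix (Fin n) (Fin n) ℝ :=
    (diagonal fun i => if s i then 1 else -1) * (Lᵀ * B.map (Int.cast : ℤ → ℝ)) with hN
  have hdd : (diagonal fun i => if s i then (1 : ℝ) else -1) *
      (diagonal fun i => if s i then (1 : ℝ) else -1) = 1 := by
    rw [diagonal_mul_diagonal, ← diagonal_one]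
    congr 1
    ext i
    split_ifs <;> simp
  have hLN : L * N = 1 := by
    rw [mul_eq_one_comm, hN, Matrix.mul_assoc, hD, hdd]
  have hunit : IsUnit B.det := Int.isUnit_iff.2 hBunimodular
  have hbij : Function.Bijective fun z : Fin n → ℤ => B *ᵥ z :=
    ⟨mulVec_injective_of_isUnit ((isUnit_iff_isUnit_det B).2 hunit),
      mulVec_surjective_iff_isUnit.2 ((isUnit_iff_isUnit_det B).2 hunit)⟩
  have hterm := siegelNarainThetaTerm_eq_cexp hcompl.disjoint hLN hLpos hLneg hD hP hM hPM
  have hb : ∀ i, 0 < (if s i then -(Real.pi * Complex.I * (-1 / τ))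
      else Real.pi * Complex.I * (starRingEnd ℂ) (-1 / τ)).re := by
    have him : 0 < (-1 / τ).im := by
      have := Complex.normSq_pos.2 h0
      rw [neg_div, one_div, Complex.neg_im, Complex.inv_im, neg_div, neg_neg]
      positivity
    intro i
    generalize -1 / τ = w at him
    have : 0 < Real.pi * w.im := by positivity
    split_ifs <;> simpa using this
  simp_rw [siegelNarainTheta, hterm]
  rw [tsum_cexp_neg_sum_sq_mulVec hb hLN hL, ← (Equiv.ofBijective _ hbij).tsum_eq]
  have hprod : ∏ i, ((Real.pi : ℂ) / (if s i then -(Real.pi * Complex.I * (-1 / τ))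
      else Real.pi * Complex.I * (starRingEnd ℂ) (-1 / τ))) ^ (1 / 2 : ℂ) =
      τ ^ ((p : ℂ) / 2) * ((starRingEnd ℂ) τ) ^ ((q : ℂ) / 2) := by
    rw [← cpow_mul_cpow_conj_eq hτ hsig, ← hp, ← hq, ← hcp, ← hcq]
    have hfactor : ∀ i, ((Real.pi : ℂ) / (if s i then -(Real.pi * Complex.I * (-1 / τ))
        else Real.pi * Complex.I * (starRingEnd ℂ) (-1 / τ))) ^ (1 / 2 : ℂ) =
        if s i then (-Complex.I * τ) ^ (1 / 2 : ℂ)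
          else (Complex.I * (starRingEnd ℂ) τ) ^ (1 / 2 : ℂ) := by
      intro i
      split_ifs
      · congr 1
        field_simp
        simp
      · congr 1
        simp only [map_div₀, map_neg, map_one]
        field_simp
        simp
    simp_rw [hfactor, Finset.prod_ite, Finset.prod_const, Fintype.card_subtype,
      Bool.not_eq_true]
  rw [hprod]
  congr 1
  refine tsum_congr fun z => ?_
  congr 2
  refine Finset.sum_congr rfl fun i _ => ?_
  have hNz : ((Lᵀ *ᵥ fun j => (((Equiv.ofBijective _ hbij) z j : ℤ) : ℝ)) i) =
      (if s i then 1 else -1) * (N *ᵥ fun j => (z j : ℝ)) i := by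
    have hcast : (fun j => (((Equiv.ofBijective _ hbij) z j : ℤ) : ℝ)) =
        B.map (Int.cast : ℤ → ℝ) *ᵥ fun j => (z j : ℝ) := by
      ext j
      simp [mulVec, dotProduct]
    rw [hcast, mulVec_mulVec, ← mulVec_diagonal (fun i => if s i then (1 : ℝ) else -1),
      mulVec_mulVec, hN, ← Matrix.mul_assoc, hdd, Matrix.one_mul]
  rw [hNz]
  by_cases h : s i
  · simp only [h, if_true, one_mul]
    congr 1
    field_simp
    simp
  · simp only [h, Bool.false_eq_true, if_false, map_div₀, map_neg, map_one]
    push_cast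
    rw [neg_one_mul, neg_sq]
    congr 1
    field_simp
    simp
end
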